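/- arXiv:1107.2159 — 2 statements merged into one kernel-verified Lean document; each statement's English description precedes it below -/
import Mathlib

section
/- For every integer n ≥ 1, the number of pairs (x,y) with coordinates in the finite field with 3^n elements satisfying y² = x⁵ + x³ + x² − x − 1 is equal to the number of pairs (x,y) with coordinates in the finite field with 3^n elements satisfying y² = x⁵ − x³ + x² − x − 1. -/
/-- The number of affine points `(x, y)` with coordinates in the finite field with `3 ^ n`
elements satisfying `y² = x⁵ + c₃ · x³ + x² − x − 1` (with `c₃ = ±1`). -/
noncomputable def howePointCount (c₃ : ℤ) (n : ℕ) : ℕ :=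
  Nat.card {p : GaloisField 3 n × GaloisField 3 n //
    p.2 ^ 2 = p.1 ^ 5 + (c₃ : GaloisField 3 n) * p.1 ^ 3 + p.1 ^ 2 - p.1 - 1}

open Polynomial

namespace Howe

abbrev F := ZMod 3

/-- monic polynomials of degree `d` over `F`. -/
noncomputable def Mon (d : ℕ) : Finset F[X] :=
  Finset.univ.image (fun c : Fin d → F => X ^ d + ∑ i : Fin d, C (c i) * X ^ (i : ℕ))

lemma natDegree_sum_lt (d : ℕ) (c : Fin d → F) :
    (∑ i : Fin d, C (c i) * X ^ (i : ℕ) : F[X]).degree < d := by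
  exact (Polynomial.degree_sum_fin_lt c)

lemma mem_Mon {d : ℕ} {g : F[X]} : g ∈ Mon d ↔ g.Monic ∧ g.natDegree = d := by
  unfold Mon
  simp only [Finset.mem_image, Finset.mem_univ, true_and]
  constructor
  · rintro ⟨c, rfl⟩
    refine ⟨monic_X_pow_add (natDegree_sum_lt d c), ?_⟩
    rw [natDegree_add_eq_left_of_degree_lt]
    · simp
    · simpa using natDegree_sum_lt d c
  · rintro ⟨hm, rfl⟩
    refine ⟨fun i => g.coeff i, ?_⟩
    conv_rhs => rw [hm.as_sum]
    rw [Finset.sum_range]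

lemma Mon_inj (d : ℕ) : Function.Injective
    (fun c : Fin d → F => (X ^ d + ∑ i : Fin d, C (c i) * X ^ (i : ℕ) : F[X])) := by
  intro c c' h
  funext i
  have := congrArg (fun p => p.coeff (i : ℕ)) h
  simpa [finsetSum_coeff, coeff_X_pow, Fin.val_inj] using this

variable {ι : Type} [Fintype ι] [DecidableEq ι]

/-- the multiplicative character attached to a matrix. -/
noncomputable def w (M : Matrix ι ι F) (g : F[X]) : ℤ := quadraticChar F (aeval M g).det

lemma w_mul (M : Matrix ι ι F) (g h : F[X]) : w M (g * h) = w M g * w M h := by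
  rw [w, map_mul, Matrix.det_mul, map_mul]; rfl

lemma w_pow (M : Matrix ι ι F) (g : F[X]) (k : ℕ) : w M (g ^ k) = w M g ^ k := by
  rw [w, map_pow, Matrix.det_pow, map_pow]; rfl

noncomputable def a (M : Matrix ι ι F) (d : ℕ) : ℤ := ∑ g ∈ Mon d, w M g

lemma a_zero (M : Matrix ι ι F) : a M 0 = 1 := by
  simp [a, Mon, w]

open Classical in
/-- weighted prime-power sums -/
noncomputable def B (M : Matrix ι ι F) (n : ℕ) : ℤ :=
  ∑ d ∈ n.divisors, ∑ P ∈ Mon d with Irreducible P, (d : ℤ) * w M P ^ (n / d)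

lemma a_eq_zero (M : Matrix ι ι F) (hodd : Odd (Fintype.card ι)) (d : ℕ)
    (hd : Fintype.card ι ≤ d) : a M d = 0 := by
  set f := M.charpoly with hf
  have hfm : f.Monic := M.charpoly_monic
  have hfd : f.natDegree = Fintype.card ι := M.charpoly_natDegree_eq_dim
  have hpos : 0 < Fintype.card ι := hodd.pos
  have hM : aeval M f = 0 := M.aeval_self_charpoly
  have hf1 : f ≠ 1 := by
    intro h; rw [h] at hfd; simp at hfd; omega
  have hmod : ∀ g : F[X], aeval M (g %ₘ f) = aeval M g := by
    intro g
    conv_rhs => rw [← modByMonic_add_div g f]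
    simp [hM]
  let τ : F[X] → F[X] := fun g => g - 2 * (g %ₘ f)
  have hτw : ∀ g, w M (τ g) = - w M g := by
    intro g
    have : aeval M (τ g) = - aeval M g := by
      simp only [τ, map_sub, map_mul, hmod, map_ofNat]
      rw [two_mul]; abel
    rw [w, this, Matrix.det_neg, hodd.neg_one_pow, map_mul]
    have : quadraticChar F (-1) = -1 := by decide
    rw [this, w]; ring
  have hτdeg : ∀ g ∈ Mon d, (2 * (g %ₘ f)).degree < g.degree := by
    intro g hg
    rw [mem_Mon] at hg
    have h2 : (2 * (g %ₘ f)) = (2 : F) • (g %ₘ f) := by rw [smul_eq_C_mul]; rfl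
    rw [h2]
    refine (degree_smul_le (2 : F) _).trans_lt ?_
    refine (degree_modByMonic_lt g hfm).trans_le ?_
    rw [degree_eq_natDegree hfm.ne_zero, degree_eq_natDegree hg.1.ne_zero, hfd, hg.2]
    exact_mod_cast hd
  have hτmem : ∀ g ∈ Mon d, τ g ∈ Mon d := by
    intro g hg
    have h1 := hτdeg g hg
    rw [mem_Mon] at hg ⊢
    refine ⟨hg.1.sub_of_left h1, ?_⟩
    rw [← hg.2]
    exact natDegree_eq_of_degree_eq (degree_sub_eq_left_of_degree_lt h1)
  have hττ : ∀ g, τ (τ g) = g := by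
    intro g
    have : τ g %ₘ f = - (g %ₘ f) := by
      have h2 : (2 * (g %ₘ f)) = (2 : F) • (g %ₘ f) := by rw [smul_eq_C_mul]; rfl
      simp only [τ, sub_modByMonic, h2, smul_modByMonic]
      rw [(modByMonic_eq_self_iff hfm).2 (degree_modByMonic_lt g hfm), ofNat_smul_eq_nsmul, two_smul]
      abel
    have h3 : τ (τ g) = τ g - 2 * (τ g %ₘ f) := rfl
    rw [h3, this]; simp only [τ]; ring
  have key : a M d = - a M d := by
    unfold a
    rw [← Finset.sum_neg_distrib]
    refine Finset.sum_bij' (fun g _ => τ g) (fun g _ => τ g) hτmem hτmem (fun g _ => hττ g)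
      (fun g _ => hττ g) ?_
    intro g _
    rw [hτw]; ring
  omega

open Classical in
/-- the degree formula -/
lemma deg_formula {n : ℕ} {g : F[X]} (hg : g ∈ Mon n) (T : Finset F[X])
    (hT : ∀ P, P ∈ T ↔ (P.Monic ∧ P.natDegree ≤ n ∧ Irreducible P)) :
    (n : ℤ) = ∑ P ∈ T, ∑ j ∈ Finset.Icc 1 n, if P ^ j ∣ g then (P.natDegree : ℤ) else 0 := by
  classical
  obtain ⟨hm, hd⟩ := mem_Mon.1 hg
  have h0 := hm.ne_zero
  have hprod : (UniqueFactorizationMonoid.normalizedFactors g).prod = g := by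
    rw [UniqueFactorizationMonoid.prod_normalizedFactors_eq h0]
    exact hm.normalize_eq_self
  have hirr : ∀ P ∈ UniqueFactorizationMonoid.normalizedFactors g,
      Irreducible P ∧ P.Monic ∧ P ∣ g := by
    intro P hP
    have hi := UniqueFactorizationMonoid.irreducible_of_normalized_factor P hP
    refine ⟨hi, ?_, UniqueFactorizationMonoid.dvd_of_mem_normalizedFactors hP⟩
    have := UniqueFactorizationMonoid.normalize_normalized_factor P hP
    rw [← this]
    exact monic_normalize hi.ne_zero
  have hsum : n = ((UniqueFactorizationMonoid.normalizedFactors g).map natDegree).sum := by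
    conv_lhs => rw [← hd, ← hprod]
    exact natDegree_multiset_prod_of_monic _ (fun P hP => (hirr P hP).2.1)
  have hsub : (UniqueFactorizationMonoid.normalizedFactors g).toFinset ⊆ T := by
    intro P hP
    rw [Multiset.mem_toFinset] at hP
    obtain ⟨h1, h2, h3⟩ := hirr P hP
    exact (hT P).2 ⟨h2, hd ▸ natDegree_le_of_dvd h3 h0, h1⟩
  conv_lhs => rw [hsum]
  rw [Finset.sum_multiset_map_count, Finset.sum_subset hsub]
  · push_cast
    refine Finset.sum_congr rfl fun P hP => ?_
    obtain ⟨h1, h2, h3⟩ := (hT P).1 hP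
    have hpow : ∀ j, P ^ j ∣ g ↔ j ≤ (UniqueFactorizationMonoid.normalizedFactors g).count P := by
      intro j
      rw [pow_dvd_iff_le_emultiplicity,
        UniqueFactorizationMonoid.emultiplicity_eq_count_normalizedFactors h3 h0,
        h1.normalize_eq_self]
      exact_mod_cast Iff.rfl
    have hle : (UniqueFactorizationMonoid.normalizedFactors g).count P ≤ n := by
      have h4 := natDegree_le_of_dvd ((hpow _).2 le_rfl) h0
      rw [natDegree_pow, hd] at h4
      have := h3.natDegree_pos
      nlinarith
    rw [← Finset.sum_filter, Finset.sum_const]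
    have : (Finset.Icc 1 n).filter (fun j => P ^ j ∣ g) =
        Finset.Icc 1 ((UniqueFactorizationMonoid.normalizedFactors g).count P) := by
      ext j
      simp only [Finset.mem_filter, Finset.mem_Icc, hpow]
      omega
    rw [this]; simp
  · intro P _ hP
    rw [Multiset.mem_toFinset] at hP
    simp [Multiset.count_eq_zero_of_notMem hP]

open Classical in
lemma sum_dvd (M : Matrix ι ι F) {n : ℕ} {Q : F[X]} (hQ : Q.Monic) :
    ∑ g ∈ Mon n, (if Q ∣ g then w M g else 0) =
      if Q.natDegree ≤ n then w M Q * a M (n - Q.natDegree) else 0 := by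
  classical
  split_ifs with h
  · rw [← Finset.sum_filter, a, Finset.mul_sum]
    symm
    refine Finset.sum_bij (fun h _ => Q * h) ?_ ?_ ?_ ?_
    · intro g hg
      rw [mem_Mon] at hg
      rw [Finset.mem_filter, mem_Mon]
      refine ⟨⟨hQ.mul hg.1, ?_⟩, dvd_mul_right _ _⟩
      rw [hQ.natDegree_mul hg.1, hg.2]; omega
    · intro g _ g' _ h
      exact mul_left_cancel₀ hQ.ne_zero h
    · intro g hg
      rw [Finset.mem_filter, mem_Mon] at hg
      obtain ⟨⟨h1, h2⟩, k, rfl⟩ := hg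
      have hk : k.Monic := hQ.of_mul_monic_left h1
      refine ⟨k, ?_, rfl⟩
      rw [mem_Mon]
      rw [hQ.natDegree_mul hk] at h2
      exact ⟨hk, by omega⟩
    · intro g _; rw [w_mul]
  · refine Finset.sum_eq_zero fun g hg => ?_
    rw [if_neg]
    intro hd
    rw [mem_Mon] at hg
    have := natDegree_le_of_dvd hd hg.1.ne_zero
    omega

lemma newton (M : Matrix ι ι F) (n : ℕ) :
    (n : ℤ) * a M n = ∑ k ∈ Finset.Icc 1 n, B M k * a M (n - k) := by
  classical
  let T : Finset F[X] := (Finset.Icc 1 n).biUnion (fun d => (Mon d).filter Irreducible)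
  have hT : ∀ P, P ∈ T ↔ (P.Monic ∧ P.natDegree ≤ n ∧ Irreducible P) := by
    intro P
    simp only [T, Finset.mem_biUnion, Finset.mem_filter, mem_Mon, Finset.mem_Icc]
    constructor
    · rintro ⟨d, hd, ⟨h1, rfl⟩, h2⟩
      exact ⟨h1, hd.2, h2⟩
    · rintro ⟨h1, h2, h3⟩
      exact ⟨_, ⟨h3.natDegree_pos, h2⟩, ⟨h1, rfl⟩, h3⟩
  have hTsum : ∀ φ : F[X] → ℤ, ∑ P ∈ T, φ P =
      ∑ d ∈ Finset.Icc 1 n, ∑ P ∈ Mon d with Irreducible P, φ P := by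
    intro φ
    apply Finset.sum_biUnion
    intro d _ d' _ hdd
    rw [Function.onFun, Finset.disjoint_left]
    intro P h1 h2
    rw [Finset.mem_filter, mem_Mon] at h1 h2
    exact hdd (h1.1.2.symm.trans h2.1.2)
  have step1 : (n : ℤ) * a M n = ∑ P ∈ T, ∑ j ∈ Finset.Icc 1 n,
      (P.natDegree : ℤ) * (if j * P.natDegree ≤ n then w M P ^ j * a M (n - j * P.natDegree)
        else 0) := by
    calc (n : ℤ) * a M n = ∑ g ∈ Mon n, ∑ P ∈ T, ∑ j ∈ Finset.Icc 1 n,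
          (P.natDegree : ℤ) * (if P ^ j ∣ g then w M g else 0) := by
          rw [a, Finset.mul_sum]
          refine Finset.sum_congr rfl fun g hg => ?_
          conv_lhs => rw [deg_formula hg T hT]
          rw [Finset.sum_mul]
          refine Finset.sum_congr rfl fun P _ => ?_
          rw [Finset.sum_mul]
          refine Finset.sum_congr rfl fun j _ => ?_
          split_ifs <;> simp
      _ = _ := by
          rw [Finset.sum_comm]
          refine Finset.sum_congr rfl fun P hP => ?_
          rw [Finset.sum_comm]
          refine Finset.sum_congr rfl fun j _ => ?_
          have hP' := ((hT P).1 hP).1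
          rw [← Finset.mul_sum, sum_dvd M (hP'.pow j), natDegree_pow, w_pow]
  rw [step1, hTsum]
  -- regroup
  have rhs : ∀ k ∈ Finset.Icc 1 n, B M k * a M (n - k) =
      ∑ d ∈ Finset.Icc 1 n, ∑ P ∈ Mon d with Irreducible P,
        if d ∣ k then (d : ℤ) * (w M P ^ (k / d) * a M (n - k)) else 0 := by
    intro k hk
    rw [Finset.mem_Icc] at hk
    rw [B, Finset.sum_mul]
    have : k.divisors = (Finset.Icc 1 n).filter (fun d => d ∣ k) := by
      ext d
      simp only [Nat.mem_divisors, Finset.mem_filter, Finset.mem_Icc]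
      constructor
      · rintro ⟨h1, h2⟩
        exact ⟨⟨Nat.pos_of_dvd_of_pos h1 (by omega), (Nat.le_of_dvd (by omega) h1).trans hk.2⟩, h1⟩
      · rintro ⟨h1, h2⟩
        exact ⟨h2, by omega⟩
    rw [this, Finset.sum_filter]
    refine Finset.sum_congr rfl fun d _ => ?_
    split_ifs with h
    · rw [Finset.sum_mul]
      refine Finset.sum_congr rfl fun P _ => by ring
    · simp
  rw [Finset.sum_congr rfl rhs, Finset.sum_comm]
  refine Finset.sum_congr rfl fun d hd => ?_
  rw [Finset.mem_Icc] at hd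
  rw [Finset.sum_comm (s := Finset.Icc 1 n)]
  refine Finset.sum_congr rfl fun P hP => ?_
  rw [Finset.mem_filter, mem_Mon] at hP
  rw [hP.1.2]
  simp only [mul_ite, mul_zero]
  rw [← Finset.sum_filter, ← Finset.sum_filter]
  refine Finset.sum_bij (fun j _ => j * d) ?_ ?_ ?_ ?_
  · intro j hj
    simp only [Finset.mem_filter, Finset.mem_Icc] at hj ⊢
    exact ⟨⟨Nat.mul_pos (by omega) (by omega), hj.2⟩, dvd_mul_left _ _⟩
  · intro j _ j' _ h
    exact Nat.eq_of_mul_eq_mul_right (by omega) h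
  · intro k hk
    simp only [Finset.mem_filter, Finset.mem_Icc] at hk
    obtain ⟨hk1, j, rfl⟩ := hk
    refine ⟨j, ?_, mul_comm _ _⟩
    simp only [Finset.mem_filter, Finset.mem_Icc]
    refine ⟨⟨?_, ?_⟩, by rw [mul_comm]; exact hk1.2⟩
    · rcases j with _ | j
      · simp at hk1
      · omega
    · nlinarith
  · intro j _
    rw [Nat.mul_div_cancel _ (by omega)]

lemma B_eq (M N : Matrix ι ι F) (h : ∀ d, a M d = a N d) (n : ℕ) (hn : 1 ≤ n) :
    B M n = B N n := by
  induction n using Nat.strong_induction_on with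
  | _ n ih =>
    have h1 := newton M n
    have h2 := newton N n
    obtain ⟨m, rfl⟩ : ∃ m, n = m + 1 := ⟨n - 1, by omega⟩
    rw [Finset.sum_Icc_succ_top (by omega), Nat.sub_self, a_zero] at h1 h2
    have : ∑ k ∈ Finset.Icc 1 m, B M k * a M (m + 1 - k) =
        ∑ k ∈ Finset.Icc 1 m, B N k * a N (m + 1 - k) := by
      refine Finset.sum_congr rfl fun k hk => ?_
      rw [Finset.mem_Icc] at hk
      rw [ih k (by omega) hk.1, h]
    rw [h, h2, this] at h1
    linarith


section field
set_option linter.unusedSectionVars false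
variable {K : Type} [Field K] [Fintype K] [DecidableEq K] [Algebra F K]

lemma ringChar_ne_two : ringChar K ≠ 2 := by
  have : CharP K 3 := charP_of_injective_algebraMap (algebraMap F K).injective 3
  rw [ringChar.eq K 3]; norm_num

lemma char_norm (z : K) : quadraticChar K z = quadraticChar F (Algebra.norm F z) := by
  have h1 : (quadraticChar K z : K) = z ^ (Fintype.card K / 2) :=
    quadraticChar_eq_pow_of_char_ne_two' ringChar_ne_two z
  have h2 : ∀ c : F, ((quadraticChar F c : ℤ) : F) = c := by decide
  have h3 : ((quadraticChar F (Algebra.norm F z) : ℤ) : K) = z ^ (Fintype.card K / 2) := by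
    have := congrArg (algebraMap F K) (h2 (Algebra.norm F z))
    rw [map_intCast] at this
    rw [this, FiniteField.algebraMap_norm_eq_pow_sum]
    congr 1
    have hc : Fintype.card K = 3 ^ Module.finrank F K := by
      rw [Module.card_eq_pow_finrank (K := F), ZMod.card]
    rw [hc, Nat.card_zmod, Nat.geomSum_eq (by norm_num)]
    have h5 : 3 ^ Module.finrank F K % 2 = 1 := by simp [Nat.pow_mod]
    omega
  have h4 : ((quadraticChar K z : ℤ) : K) = ((quadraticChar F (Algebra.norm F z) : ℤ) : K) := by
    rw [h1, h3]
  have hK := ringChar_ne_two (K := K)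
  rcases quadraticChar_isQuadratic K z with h | h | h <;>
  rcases quadraticChar_isQuadratic F (Algebra.norm F z) with h' | h' | h' <;>
  rw [h, h'] at h4 ⊢ <;> exfalso
  · simp at h4
  · simp at h4
  · simp at h4
  · exact Ring.neg_one_ne_one_of_char_ne_two hK (by simpa using h4.symm)
  · simp at h4
  · exact Ring.neg_one_ne_one_of_char_ne_two hK (by simpa using h4)

lemma prod_conj (x : K) : ∏ σ : K ≃ₐ[F] K, (X - C (σ x)) =
    ((minpoly F x) ^ (Module.finrank F K / (minpoly F x).natDegree)).map (algebraMap F K) := by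
  classical
  have hx : IsIntegral F x := Algebra.IsIntegral.isIntegral x
  obtain ⟨q, hq1, hq2, hq3⟩ := Polynomial.lifts_and_natDegree_eq_and_monic
    (Algebra.IsInvariant.charpoly_mem_lifts F K (K ≃ₐ[F] K) x)
    (MulSemiringAction.monic_charpoly _ x)
  have hq1' : q.map (algebraMap F K) = ∏ σ : K ≃ₐ[F] K, (X - C (σ x)) := hq1
  rw [← hq1']
  congr 1
  have hPm := minpoly.monic hx
  have hPi := minpoly.irreducible hx
  have hfac : ∀ P ∈ UniqueFactorizationMonoid.normalizedFactors q, P = minpoly F x := by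
    intro P hP
    have hi := UniqueFactorizationMonoid.irreducible_of_normalized_factor P hP
    have hm : P.Monic := by
      rw [← UniqueFactorizationMonoid.normalize_normalized_factor P hP]
      exact monic_normalize hi.ne_zero
    have hdvd := UniqueFactorizationMonoid.dvd_of_mem_normalizedFactors hP
    have hd2 := Polynomial.map_dvd (algebraMap F K) hdvd
    have hs : (P.map (algebraMap F K)).Splits := by
      refine Splits.of_dvd ?_ (hq3.map _).ne_zero hd2
      rw [hq1]; exact MulSemiringAction.splits_charpoly _ x
    obtain ⟨y, hy⟩ := hs.exists_eval_eq_zero (by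
      rw [degree_map]; exact (degree_pos_of_irreducible hi).ne')
    have hy2 : (q.map (algebraMap F K)).eval y = 0 := eval_eq_zero_of_dvd_of_eval_eq_zero hd2 hy
    rw [hq1', eval_prod, Finset.prod_eq_zero_iff] at hy2
    obtain ⟨σ, -, hσ⟩ := hy2
    have hσ' : y = σ x := by simpa [sub_eq_zero] using hσ
    have : P = minpoly F y := minpoly.eq_of_irreducible_of_monic hi (by rw [aeval_def, ← eval_map]; exact hy) hm
    rw [this, hσ']
    exact minpoly.algEquiv_eq σ x
  have hrep := Multiset.eq_replicate_card.2 hfac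
  have hprod : (UniqueFactorizationMonoid.normalizedFactors q).prod = q := by
    rw [UniqueFactorizationMonoid.prod_normalizedFactors_eq hq3.ne_zero]
    exact hq3.normalize_eq_self
  rw [hrep, Multiset.prod_replicate] at hprod
  have hdeg : q.natDegree = Module.finrank F K := by
    rw [← natDegree_map (algebraMap F K), hq1', natDegree_prod_of_monic _ _ (fun σ _ => monic_X_sub_C _)]
    simp only [natDegree_X_sub_C, Finset.sum_const, Finset.card_univ, smul_eq_mul, mul_one]
    rw [← Nat.card_eq_fintype_card]
    exact IsGalois.card_aut_eq_finrank F K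
  rw [← hprod, natDegree_pow] at hdeg
  rw [← hdeg, Nat.mul_div_cancel _ hPi.natDegree_pos, hprod]

lemma w_minpoly (M : Matrix ι ι F) (hodd : Odd (Fintype.card ι)) (x : K) :
    w M (minpoly F x) ^ (Module.finrank F K / (minpoly F x).natDegree) =
      quadraticChar K (- aeval x M.charpoly) := by
  classical
  rw [← w_pow, char_norm, w]
  congr 1
  apply (algebraMap F K).injective
  rw [Algebra.norm_eq_prod_automorphisms]
  set Q := (minpoly F x) ^ (Module.finrank F K / (minpoly F x).natDegree) with hQ
  have hpc := prod_conj x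
  rw [← hQ] at hpc
  have h1 : (algebraMap F K).mapMatrix (aeval M Q) =
      aeval ((algebraMap F K).mapMatrix M) (Q.map (algebraMap F K)) := by
    rw [aeval_map_algebraMap]
    exact (aeval_algHom_apply ((Algebra.ofId F K).mapMatrix) M Q).symm
  rw [RingHom.map_det, h1, ← hpc]
  have h2 : ∀ σ : K ≃ₐ[F] K, σ (- aeval x M.charpoly) =
      (aeval ((algebraMap F K).mapMatrix M) (X - C (σ x))).det := by
    intro σ
    rw [map_neg, ← aeval_algHom_apply σ x, aeval_def, ← eval_map, ← Matrix.charpoly_map,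
      Matrix.eval_charpoly, map_sub, aeval_X, aeval_C]
    rw [← neg_sub (algebraMap K (Matrix ι ι K) (σ x)), Matrix.det_neg, hodd.neg_one_pow, neg_one_mul]
    rfl
  simp_rw [h2]
  exact map_prod (Matrix.detMonoidHom.comp
    ((aeval ((algebraMap F K).mapMatrix M) : K[X] →ₐ[K] Matrix ι ι K) : K[X] →* Matrix ι ι K))
    (fun σ : K ≃ₐ[F] K => X - C (σ x)) Finset.univ

lemma card_minpoly {n : ℕ} (hn : n = Module.finrank F K) {P : F[X]} (hm : P.Monic) (hi : Irreducible P)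
    (hd : P.natDegree ∣ n) :
    (Finset.univ.filter (fun x : K => minpoly F x = P)).card = P.natDegree := by
  classical
  have hsep : P.Separable := PerfectField.separable_of_irreducible hi
  have hc : Fintype.card K = 3 ^ n := by
    rw [Module.card_eq_pow_finrank (K := F), ZMod.card, hn]
  have hs : (P.map (algebraMap F K)).Splits := by
    have h1 := hi.natDegree_dvd_iff_dvd_X_pow_card_pow_sub_X.1 hd
    have h2 := Polynomial.map_dvd (algebraMap F K) h1
    have h3 : (X ^ (Nat.card F) ^ n - X : F[X]).map (algebraMap F K) = X ^ (Nat.card K) - X := by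
      simp [hc]
    rw [h3] at h2
    refine Splits.of_dvd Polynomial.splits_X_pow_nat_card_sub_X ?_ h2
    rw [Nat.card_eq_fintype_card]
    exact FiniteField.X_pow_card_sub_X_ne_zero K Fintype.one_lt_card
  rw [← card_rootSet_eq_natDegree hsep hs, ← Set.toFinset_card]
  congr 1
  ext x
  simp only [Finset.mem_filter, Finset.mem_univ, true_and, Set.mem_toFinset, mem_rootSet]
  constructor
  · rintro rfl
    exact ⟨hm.ne_zero, minpoly.aeval F x⟩
  · rintro ⟨_, h⟩
    exact (minpoly.eq_of_irreducible_of_monic hi h hm).symm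

lemma B_eq_sum (M : Matrix ι ι F) (hodd : Odd (Fintype.card ι)) :
    B M (Module.finrank F K) = ∑ x : K, quadraticChar K (- aeval x M.charpoly) := by
  classical
  have hpos : 0 < Module.finrank F K := Module.finrank_pos
  let T : Finset F[X] := (Module.finrank F K).divisors.biUnion (fun d => (Mon d).filter Irreducible)
  have hmap : ∀ x ∈ (Finset.univ : Finset K), minpoly F x ∈ T := by
    intro x _
    have hx : IsIntegral F x := Algebra.IsIntegral.isIntegral x
    simp only [T, Finset.mem_biUnion, Finset.mem_filter, mem_Mon, Nat.mem_divisors]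
    exact ⟨_, ⟨minpoly.degree_dvd hx, hpos.ne'⟩,
      ⟨minpoly.monic hx, rfl⟩, minpoly.irreducible hx⟩
  rw [← Finset.sum_fiberwise_of_maps_to hmap, Finset.sum_biUnion, B]
  · refine Finset.sum_congr rfl fun d hd => ?_
    refine Finset.sum_congr rfl fun P hP => ?_
    rw [Finset.mem_filter, mem_Mon] at hP
    obtain ⟨⟨h1, rfl⟩, h3⟩ := hP
    rw [Finset.sum_congr rfl (g := fun _ => w M P ^ (Module.finrank F K / P.natDegree))]
    · rw [Finset.sum_const, card_minpoly rfl h1 h3 (Nat.mem_divisors.1 hd).1]; simp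
    · intro x hx
      rw [Finset.mem_filter] at hx
      rw [← w_minpoly M hodd, hx.2]
  · intro d _ d' _ hdd
    rw [Function.onFun, Finset.disjoint_left]
    intro P h1 h2
    rw [Finset.mem_filter, mem_Mon] at h1 h2
    exact hdd (h1.1.2.symm.trans h2.1.2)

lemma card_points (f : K → K) : (Nat.card {p : K × K // p.2 ^ 2 = f p.1} : ℤ) =
    Fintype.card K + quadraticChar K (-1) * ∑ x : K, quadraticChar K (- f x) := by
  classical
  have e : {p : K × K // p.2 ^ 2 = f p.1} ≃ Σ x : K, {y : K // y ^ 2 = f x} :=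
    { toFun := fun p => ⟨p.1.1, p.1.2, p.2⟩
      invFun := fun s => ⟨(s.1, s.2.1), s.2.2⟩
      left_inv := fun _ => rfl
      right_inv := fun _ => rfl }
  rw [Nat.card_congr e, Nat.card_sigma, Finset.mul_sum]
  push_cast
  have : (Fintype.card K : ℤ) = ∑ x : K, 1 := by simp
  rw [this, ← Finset.sum_add_distrib]
  refine Finset.sum_congr rfl fun x _ => ?_
  rw [← map_mul]
  have h := quadraticChar_card_sqrts ringChar_ne_two (f x)
  rw [show -1 * -f x = f x by ring, add_comm, ← h]
  rw [Set.toFinset_card, ← Nat.card_eq_fintype_card]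
  rfl
end field

/-- companion matrix of `x⁵ + e x³ + x² - x - 1` -/
def Cm (e : F) : Matrix (Fin 5) (Fin 5) F :=
  !![0,0,0,0,1; 1,0,0,0,1; 0,1,0,0,-1; 0,0,1,0,-e; 0,0,0,1,0]

lemma Cm_charpoly (e : F) : (Cm e).charpoly = X ^ 5 + C e * X ^ 3 + X ^ 2 - X - 1 := by
  unfold Matrix.charpoly Matrix.charmatrix Cm
  simp [Matrix.det_succ_row_zero, Fin.sum_univ_succ, Fin.succAbove, Matrix.submatrix]
  ring


/-- `3 × 3` minor on rows 2, 3, 4 and columns `i, j, k` -/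
def m3 (m : Matrix (Fin 5) (Fin 5) F) (i j k : Fin 5) : F :=
  m 2 i * (m 3 j * m 4 k - m 3 k * m 4 j) - m 2 j * (m 3 i * m 4 k - m 3 k * m 4 i)
    + m 2 k * (m 3 i * m 4 j - m 3 j * m 4 i)

/-- `4 × 4` minor on rows 1, 2, 3, 4 -/
def m4 (m : Matrix (Fin 5) (Fin 5) F) (i j k l : Fin 5) : F :=
  m 1 i * m3 m j k l - m 1 j * m3 m i k l + m 1 k * m3 m i j l - m 1 l * m3 m i j k

/-- Laplace expansion of a `5 × 5` determinant -/
def m5 (m : Matrix (Fin 5) (Fin 5) F) : F :=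
  m 0 0 * m4 m 1 2 3 4 - m 0 1 * m4 m 0 2 3 4 + m 0 2 * m4 m 0 1 3 4 - m 0 3 * m4 m 0 1 2 4
    + m 0 4 * m4 m 0 1 2 3

lemma det_eq_m5 (m : Matrix (Fin 5) (Fin 5) F) : m.det = m5 m := by
  simp [Matrix.det_succ_row_zero, Fin.sum_univ_succ, Fin.succAbove, Matrix.submatrix, m5, m4, m3]
  ring

/-- matrix of `c₀ + c₁ C + ⋯ + c₄ C⁴` -/
def gm (e c0 c1 c2 c3 c4 : F) : Matrix (Fin 5) (Fin 5) F :=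
  !![c0, c4, c3, c2 + c4 * (-e), c1 + c3 * (-e) + c4 * (-1);
    c1, c0 + c4, c3 + c4, c2 + c3 + c4 * (-e), c1 + c2 + c3 * (-e) + c4 * (-e-1);
    c2, c1 + c4 * (-1), c0 + c3 * (-1) + c4, c2 * (-1) + c3 + c4 * (1+e), c1 * (-1) + c2 + c3 * (1+e) + c4 * (1-e);
    c3, c2 + c4 * (-e), c1 + c3 * (-e) + c4 * (-1), c0 + c2 * (-e) + c3 * (-1) + c4 * (1+e*e), c1 * (-e) + c2 * (-1) + c3 * (1+e*e) + c4 * (1+2*e);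
    c4, c3, c2 + c4 * (-e), c1 + c3 * (-e) + c4 * (-1), c0 + c2 * (-e) + c3 * (-1) + c4 * (1+e*e)]

set_option linter.unusedSimpArgs false in
lemma eval_mat (e c0 c1 c2 c3 c4 : F) :
    c0 • (1 : Matrix (Fin 5) (Fin 5) F) + c1 • Cm e + c2 • (Cm e) ^ 2 + c3 • (Cm e) ^ 3
      + c4 • (Cm e) ^ 4 = gm e c0 c1 c2 c3 c4 := by
  have h2 : (Cm e) ^ 2 = !![0,0,0,1,0; 0,0,0,1,1; 1,0,0,-1,1; 0,1,0,-e,-1; 0,0,1,0,-e] := by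
    ext i j
    fin_cases i <;> fin_cases j <;> simp [Cm, pow_succ, Matrix.mul_apply, Fin.sum_univ_succ]
  have h3 : (Cm e) ^ 3 =
      !![0,0,1,0,-e; 0,0,1,1,-e; 0,0,-1,1,1+e; 1,0,-e,-1,1+e*e; 0,1,0,-e,-1] := by
    rw [pow_succ, h2]
    ext i j
    fin_cases i <;> fin_cases j <;>
      simp [Cm, pow_succ, Matrix.mul_apply, Fin.sum_univ_succ]
  have h4 : (Cm e) ^ 4 =
      !![0, 1, 0, -e, -1; 0, 1, 1, -e, -e-1; 0, -1, 1, 1+e, 1-e; 0, -e, -1, 1+e*e, 1+2*e; 1, 0, -e, -1, 1+e*e] := by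
    rw [pow_succ, h3]
    ext i j
    fin_cases i <;> fin_cases j <;>
      simp [Cm, pow_succ, Matrix.mul_apply, Fin.sum_univ_succ] <;> try ring
  rw [h2, h3, h4]
  ext i j
  fin_cases i <;> fin_cases j <;> simp [Cm, gm]

/-- computable form of the quadratic character of `F` -/
def chi (x : F) : ℤ := if x = 0 then 0 else if x = 1 then 1 else -1

lemma chi_eq (x : F) : quadraticChar F x = chi x := by
  revert x; decide

def val (e c0 c1 c2 c3 c4 : F) : ℤ := chi (m5 (gm e c0 c1 c2 c3 c4))

lemma val_eq (e c0 c1 c2 c3 c4 : F) : quadraticChar F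
    (c0 • (1 : Matrix (Fin 5) (Fin 5) F) + c1 • Cm e + c2 • (Cm e) ^ 2 + c3 • (Cm e) ^ 3
      + c4 • (Cm e) ^ 4).det = val e c0 c1 c2 c3 c4 := by
  rw [eval_mat, det_eq_m5, chi_eq, val]

lemma sum_cons (d : ℕ) (φ : (Fin (d + 1) → F) → ℤ) :
    ∑ c : Fin (d + 1) → F, φ c = ∑ x : F, ∑ c : Fin d → F, φ (Fin.cons x c) := by
  rw [← Fintype.sum_prod_type']
  exact (Fintype.sum_equiv (Fin.consEquiv (fun _ : Fin (d + 1) => F)) _ _ (fun _ => rfl)).symm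

lemma a_eq_sum (M : Matrix ι ι F) (d : ℕ) : a M d = ∑ c : Fin d → F,
    quadraticChar F (M ^ d + ∑ i : Fin d, c i • M ^ (i : ℕ)).det := by
  rw [a, Mon, Finset.sum_image (fun _ _ _ _ h => Mon_inj d h)]
  refine Finset.sum_congr rfl fun c _ => ?_
  rw [w]
  congr 2
  simp [Algebra.smul_def]

lemma a1 (e : F) : a (Cm e) 1 = ∑ x : F, val e x 1 0 0 0 := by
  rw [a_eq_sum, sum_cons]
  refine Finset.sum_congr rfl fun x _ => ?_
  rw [Fintype.sum_unique, ← val_eq]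
  refine congrArg (fun m : Matrix (Fin 5) (Fin 5) F => quadraticChar F m.det) ?_
  simp [add_comm]

lemma a2 (e : F) : a (Cm e) 2 = ∑ x : F, ∑ y : F, val e x y 1 0 0 := by
  rw [a_eq_sum, sum_cons]
  refine Finset.sum_congr rfl fun x _ => ?_
  rw [sum_cons]
  refine Finset.sum_congr rfl fun y _ => ?_
  rw [Fintype.sum_unique, ← val_eq]
  refine congrArg (fun m : Matrix (Fin 5) (Fin 5) F => quadraticChar F m.det) ?_
  simp [Fin.sum_univ_succ]
  abel

lemma a3 (e : F) : a (Cm e) 3 = ∑ x : F, ∑ y : F, ∑ z : F, val e x y z 1 0 := by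
  rw [a_eq_sum, sum_cons]
  refine Finset.sum_congr rfl fun x _ => ?_
  rw [sum_cons]
  refine Finset.sum_congr rfl fun y _ => ?_
  rw [sum_cons]
  refine Finset.sum_congr rfl fun z _ => ?_
  rw [Fintype.sum_unique, ← val_eq]
  refine congrArg (fun m : Matrix (Fin 5) (Fin 5) F => quadraticChar F m.det) ?_
  simp [Fin.sum_univ_succ]
  abel

lemma a4 (e : F) : a (Cm e) 4 = ∑ x : F, ∑ y : F, ∑ z : F, ∑ t : F, val e x y z t 1 := by
  rw [a_eq_sum, sum_cons]
  refine Finset.sum_congr rfl fun x _ => ?_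
  rw [sum_cons]
  refine Finset.sum_congr rfl fun y _ => ?_
  rw [sum_cons]
  refine Finset.sum_congr rfl fun z _ => ?_
  rw [sum_cons]
  refine Finset.sum_congr rfl fun t _ => ?_
  rw [Fintype.sum_unique, ← val_eq]
  refine congrArg (fun m : Matrix (Fin 5) (Fin 5) F => quadraticChar F m.det) ?_
  simp [Fin.sum_univ_succ]
  abel

/-- Natural-number version of `m3` (with `-1` replaced by `2`). -/
def n3 (a b c d e f g h i : ℕ) : ℕ :=
  (a * (e * i + 2 * (f * h)) + 2 * (b * (d * i + 2 * (f * g))) + c * (d * h + 2 * (e * g))) % 3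

/-- Natural-number version of `m4`. -/
def n4 (a b c d e f g h i j k l m n o p : ℕ) : ℕ :=
  (a * n3 f g h j k l n o p + 2 * (b * n3 e g h i k l m o p) + c * n3 e f h i j l m n p
    + 2 * (d * n3 e f g i j k m n o)) % 3

/-- Natural-number version of `m5`, rows given one after the other. -/
def n5 (a0 a1 a2 a3 a4 b0 b1 b2 b3 b4 c0 c1 c2 c3 c4 d0 d1 d2 d3 d4 e0 e1 e2 e3 e4 : ℕ) : ℕ :=
  (a0 * n4 b1 b2 b3 b4 c1 c2 c3 c4 d1 d2 d3 d4 e1 e2 e3 e4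
    + 2 * (a1 * n4 b0 b2 b3 b4 c0 c2 c3 c4 d0 d2 d3 d4 e0 e2 e3 e4)
    + a2 * n4 b0 b1 b3 b4 c0 c1 c3 c4 d0 d1 d3 d4 e0 e1 e3 e4
    + 2 * (a3 * n4 b0 b1 b2 b4 c0 c1 c2 c4 d0 d1 d2 d4 e0 e1 e2 e4)
    + a4 * n4 b0 b1 b2 b3 c0 c1 c2 c3 d0 d1 d2 d3 e0 e1 e2 e3) % 3

/-- Natural-number version of the determinant of `gm`. -/
def gn (e c0 c1 c2 c3 c4 : ℕ) : ℕ :=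
  n5 (c0) (c4) (c3) (c2 + c4 * (2*e)) (c1 + c3 * (2*e) + c4 * (2))
    (c1) (c0 + c4) (c3 + c4) (c2 + c3 + c4 * (2*e)) (c1 + c2 + c3 * (2*e) + c4 * (2*e+2))
    (c2) (c1 + c4 * (2)) (c0 + c3 * (2) + c4) (c2 * (2) + c3 + c4 * (1+e)) (c1 * (2) + c2 + c3 * (1+e) + c4 * (1+2*e))
    (c3) (c2 + c4 * (2*e)) (c1 + c3 * (2*e) + c4 * (2)) (c0 + c2 * (2*e) + c3 * (2) + c4 * (1+e*e)) (c1 * (2*e) + c2 * (2) + c3 * (1+e*e) + c4 * (1+2*e))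
    (c4) (c3) (c2 + c4 * (2*e)) (c1 + c3 * (2*e) + c4 * (2)) (c0 + c2 * (2*e) + c3 * (2) + c4 * (1+e*e))

lemma two_F : (2 : F) = -1 := by decide

lemma cast_mod3 (k : ℕ) : ((k % 3 : ℕ) : F) = k := ZMod.natCast_mod k 3

lemma cast_n5 (a0 a1 a2 a3 a4 b0 b1 b2 b3 b4 c0 c1 c2 c3 c4 d0 d1 d2 d3 d4 e0 e1 e2 e3 e4 : ℕ) :
    ((n5 a0 a1 a2 a3 a4 b0 b1 b2 b3 b4 c0 c1 c2 c3 c4 d0 d1 d2 d3 d4 e0 e1 e2 e3 e4 : ℕ) : F) =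
      m5 !![a0, a1, a2, a3, a4; b0, b1, b2, b3, b4; c0, c1, c2, c3, c4; d0, d1, d2, d3, d4;
        e0, e1, e2, e3, e4] := by
  simp only [n5, n4, n3, cast_mod3, Nat.cast_add, Nat.cast_mul, Nat.cast_ofNat, two_F]
  simp [m5, m4, m3]
  ring

lemma cast_gn (e c0 c1 c2 c3 c4 : ℕ) :
    ((gn e c0 c1 c2 c3 c4 : ℕ) : F) = m5 (gm e c0 c1 c2 c3 c4) := by
  rw [gn, cast_n5, gm]
  congr 1
  simp only [Nat.cast_add, Nat.cast_mul, Nat.cast_ofNat, Nat.cast_zero, Nat.cast_one, two_F]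
  ext i j
  fin_cases i <;> fin_cases j <;> simp <;> first | done | ring1 | (left; ring1)

/-- Quadratic character on a natural number less than 3. -/
def chiN : ℕ → ℤ
  | 0 => 0
  | 1 => 1
  | _ => -1

lemma chiN_eq (k : ℕ) (hk : k < 3) : chi (k : F) = chiN k := by
  interval_cases k <;> decide

lemma val_nat (e c0 c1 c2 c3 c4 : ℕ) :
    val (e : F) c0 c1 c2 c3 c4 = chiN (gn e c0 c1 c2 c3 c4) := by
  rw [val, ← cast_gn, chiN_eq]
  exact Nat.mod_lt _ (by norm_num)

/-- Sum over the residues 0, 1, 2. -/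
def S3 (φ : ℕ → ℤ) : ℤ := φ 0 + φ 1 + φ 2

lemma sum_F (φ : F → ℤ) : ∑ x : F, φ x = S3 (fun k => φ (k : F)) := by
  rw [S3, Nat.cast_zero, Nat.cast_one, Nat.cast_ofNat]
  exact Fin.sum_univ_three φ

lemma one_F : (1 : F) = ((1 : ℕ) : F) := Nat.cast_one.symm
lemma zero_F : (0 : F) = ((0 : ℕ) : F) := Nat.cast_zero.symm
lemma neg_one_F : (-1 : F) = ((2 : ℕ) : F) := by decide

lemma x1 : S3 (fun x => chiN (gn 1 x 1 0 0 0)) =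
    S3 (fun x => chiN (gn 2 x 1 0 0 0)) := by decide +kernel

lemma v1 : ∑ x : F, val 1 x 1 0 0 0 =
    ∑ x : F, val (-1) x 1 0 0 0 := by
  rw [neg_one_F, one_F, zero_F]
  simp only [sum_F, val_nat]
  exact x1

lemma x2 : S3 (fun x => S3 (fun y => chiN (gn 1 x y 1 0 0))) =
    S3 (fun x => S3 (fun y => chiN (gn 2 x y 1 0 0))) := by decide +kernel

lemma v2 : ∑ x : F, ∑ y : F, val 1 x y 1 0 0 =
    ∑ x : F, ∑ y : F, val (-1) x y 1 0 0 := by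
  rw [neg_one_F, one_F, zero_F]
  simp only [sum_F, val_nat]
  exact x2

lemma x3 : S3 (fun x => S3 (fun y => S3 (fun z => chiN (gn 1 x y z 1 0)))) =
    S3 (fun x => S3 (fun y => S3 (fun z => chiN (gn 2 x y z 1 0)))) := by decide +kernel

lemma v3 : ∑ x : F, ∑ y : F, ∑ z : F, val 1 x y z 1 0 =
    ∑ x : F, ∑ y : F, ∑ z : F, val (-1) x y z 1 0 := by
  rw [neg_one_F, one_F, zero_F]
  simp only [sum_F, val_nat]
  exact x3

lemma x4 : S3 (fun x => S3 (fun y => S3 (fun z => S3 (fun t => chiN (gn 1 x y z t 1))))) =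
    S3 (fun x => S3 (fun y => S3 (fun z => S3 (fun t => chiN (gn 2 x y z t 1))))) := by decide +kernel

lemma v4 : ∑ x : F, ∑ y : F, ∑ z : F, ∑ t : F, val 1 x y z t 1 =
    ∑ x : F, ∑ y : F, ∑ z : F, ∑ t : F, val (-1) x y z t 1 := by
  rw [neg_one_F, one_F]
  simp only [sum_F, val_nat]
  exact x4


lemma a_agree (d : ℕ) : a (Cm 1) d = a (Cm (-1)) d := by
  by_cases h : 5 ≤ d
  · rw [a_eq_zero (Cm 1) (by decide) d (by simpa using h),
      a_eq_zero (Cm (-1)) (by decide) d (by simpa using h)]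
  · have : d = 0 ∨ d = 1 ∨ d = 2 ∨ d = 3 ∨ d = 4 := by omega
    rcases this with rfl | rfl | rfl | rfl | rfl
    · rw [a_zero, a_zero]
    · rw [a1, a1, v1]
    · rw [a2, a2, v2]
    · rw [a3, a3, v3]
    · rw [a4, a4, v4]

lemma count_eq (c : ℤ) (n : ℕ) (hn : 1 ≤ n) [Fintype (GaloisField 3 n)]
    [DecidableEq (GaloisField 3 n)] : (howePointCount c n : ℤ) =
    Fintype.card (GaloisField 3 n) + quadraticChar (GaloisField 3 n) (-1) * B (Cm (c : F)) n := by
  have hfr : Module.finrank F (GaloisField 3 n) = n := GaloisField.finrank 3 (by omega)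
  have hB := B_eq_sum (K := GaloisField 3 n) (Cm (c : F)) (by decide)
  rw [hfr] at hB
  rw [hB]
  unfold howePointCount
  rw [card_points (fun x : GaloisField 3 n =>
    x ^ 5 + (c : GaloisField 3 n) * x ^ 3 + x ^ 2 - x - 1)]
  simp [Cm_charpoly]

end Howe

/-- Howe's curves `y² = x⁵ ± x³ + x² − x − 1` over `𝔽₃` have the same number of affine points
over every finite extension `𝔽_{3ⁿ}` of `𝔽₃`. -/
theorem howe_point_counts_agree (n : ℕ) (hn : 1 ≤ n) :
    howePointCount 1 n = howePointCount (-1) n := by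
  classical
  have := Fintype.ofFinite (GaloisField 3 n)
  have h1 := Howe.count_eq 1 n hn
  have h2 := Howe.count_eq (-1) n hn
  have hB := Howe.B_eq (Howe.Cm 1) (Howe.Cm (-1)) Howe.a_agree n hn
  simp only [Int.cast_one, Int.cast_neg] at h1 h2
  rw [hB, ← h2] at h1
  exact_mod_cast h1
end

section
/- Let N_n denote 1 plus the number of pairs (x,y) with coordinates in the finite field with 3^n elements satisfying y² = x⁵ + x³ + x² − x − 1 (the '+1' accounting for the unique point at infinity of the smooth projective model). Then for every n ≥ 1, regarding N_n as a complex number, N_n = 3^n + 1 − ∑ α^n, where the sum runs over the four complex roots (counted with multiplicity) of the polynomial z⁴ − z³ + z² − 3z + 9. Equivalently, the zeta function of the curve is (1 − T + T² − 3T³ + 9T⁴)/((1 − T)(1 − 3T)). -/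
open Polynomial

/-- `N n` is the number of points of the smooth projective model of Howe's curve
`y² = x⁵ + x³ + x² − x − 1` over the finite field with `3 ^ n` elements: the number of affine
points plus `1` for the unique point at infinity. -/
noncomputable def howeProjectivePointCount (n : ℕ) : ℕ :=
  1 + Nat.card {p : GaloisField 3 n × GaloisField 3 n //
    p.2 ^ 2 = p.1 ^ 5 + p.1 ^ 3 + p.1 ^ 2 - p.1 - 1}

def hf {R : Type*} [CommRing R] (x : R) : R := x ^ 5 + x ^ 3 + x ^ 2 - x - 1

def hC (R : Type*) [CommRing R] : Matrix (Fin 5) (Fin 5) R :=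
  !![0,0,0,0,1; 1,0,0,0,1; 0,1,0,0,-1; 0,0,1,0,-1; 0,0,0,1,0]

lemma det_hC {R : Type*} [CommRing R] (x : R) :
    (hC R - algebraMap R (Matrix (Fin 5) (Fin 5) R) x).det = - hf x := by
  have : hC R - algebraMap R (Matrix (Fin 5) (Fin 5) R) x =
    !![-x,0,0,0,1; 1,-x,0,0,1; 0,1,-x,0,-1; 0,0,1,-x,-1; 0,0,0,1,-x] := by
    rw [Matrix.algebraMap_eq_diagonal]
    ext i j
    fin_cases i <;> fin_cases j <;> simp [hC]
  rw [this]
  simp [hf, Matrix.det_succ_row_zero, Fin.sum_univ_succ, Fin.succAbove]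
  ring

lemma hC_root : aeval (hC (ZMod 3)) (X ^ 5 + X ^ 3 + X ^ 2 - X - 1 : (ZMod 3)[X]) = 0 := by
  have : (hC (ZMod 3))^5 + (hC (ZMod 3))^3 + (hC (ZMod 3))^2 - (hC (ZMod 3)) - 1 = 0 := by
    have e2 : hC (ZMod 3) ^ 2 = !![0,0,0,1,0;0,0,0,1,1;1,0,0,-1,1;0,1,0,-1,-1;0,0,1,0,-1] := by
      rw [pow_two]; simp [hC]
    have e3 : hC (ZMod 3) ^ 3
        = !![0,0,1,0,-1;0,0,1,1,-1;0,0,-1,1,2;1,0,-1,-1,2;0,1,0,-1,-1] := by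
      rw [pow_succ, e2]; ext i j; fin_cases i <;> fin_cases j <;> simp [hC] <;> ring
    have e5 : hC (ZMod 3) ^ 5 = hC (ZMod 3) ^ 3 * hC (ZMod 3) ^ 2 := by rw [← pow_add]
    rw [e5, e3, e2]
    ext i j
    fin_cases i <;> fin_cases j <;> simp [hC] <;> decide
  simpa using this

noncomputable def hM (d : ℕ) : Finset (ZMod 3)[X] :=
  Finset.univ.image (fun a : Fin d → ZMod 3 => X ^ d + ∑ i, C (a i) * X ^ (i : ℕ))

lemma mem_hM (d : ℕ) (g : (ZMod 3)[X]) : g ∈ hM d ↔ g.Monic ∧ g.natDegree = d := by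
  simp only [hM, Finset.mem_image, Finset.mem_univ, true_and]
  constructor
  · rintro ⟨a, rfl⟩
    have h : (∑ i, C (a i) * X ^ (i : ℕ)).degree < (d : WithBot ℕ) := by
      exact degree_sum_fin_lt a
    refine ⟨monic_X_pow_add h, ?_⟩
    apply natDegree_eq_of_degree_eq_some
    rw [degree_add_eq_left_of_degree_lt (by simpa using h)]
    simp
  · rintro ⟨hm, rfl⟩
    refine ⟨fun i => g.coeff i, ?_⟩
    conv_rhs => rw [hm.as_sum]
    rw [Finset.sum_range]

noncomputable def hchi (g : (ZMod 3)[X]) : ℤ :=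
  quadraticChar (ZMod 3) ((-1) ^ g.natDegree * (aeval (hC (ZMod 3)) g).det)

noncomputable def hc (d : ℕ) : ℤ := ∑ g ∈ hM d, hchi g

lemma hc_eq (d : ℕ) : hc d = ∑ a : Fin d → ZMod 3,
    quadraticChar (ZMod 3) ((-1) ^ d * (hC (ZMod 3) ^ d + ∑ i, a i • hC (ZMod 3) ^ (i : ℕ)).det) := by
  have hinj : Set.InjOn (fun a : Fin d → ZMod 3 => X ^ d + ∑ i, C (a i) * X ^ (i : ℕ))
      (Finset.univ : Finset (Fin d → ZMod 3)) := by
    intro a _ b _ hab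
    have h2 : ∑ i, C (a i) * X ^ (i : ℕ) = ∑ i, C (b i) * X ^ (i : ℕ) := add_left_cancel hab
    ext i
    have := congrArg (fun p => coeff p i) h2
    simpa [finsetSum_coeff, coeff_X_pow, Fin.ext_iff.symm] using this
  rw [hc, hM, Finset.sum_image hinj]
  refine Finset.sum_congr rfl fun a _ => ?_
  have h1 : (X ^ d + ∑ i, C (a i) * X ^ (i : ℕ)).natDegree = d :=
    ((mem_hM d _).1 (by simp only [hM, Finset.mem_image]; exact ⟨a, by simp, rfl⟩)).2
  rw [hchi, h1]
  simp [map_sum, Algebra.smul_def]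

def hd2 {R : Type*} [CommRing R] (x00 x01 x10 x11 : R) : R := x00 * x11 - x01 * x10

def hd3 {R : Type*} [CommRing R]
    (x00 x01 x02 x10 x11 x12 x20 x21 x22 : R) : R :=
  x00 * hd2 x11 x12 x21 x22
  - x01 * hd2 x10 x12 x20 x22 + x02 * hd2 x10 x11 x20 x21

def hd4 {R : Type*} [CommRing R]
    (x00 x01 x02 x03 x10 x11 x12 x13 x20 x21 x22 x23 x30 x31 x32 x33 : R) : R :=
  x00 * hd3 x11 x12 x13 x21 x22 x23 x31 x32 x33
  - x01 * hd3 x10 x12 x13 x20 x22 x23 x30 x32 x33 + x02 * hd3 x10 x11 x13 x20 x21 x23 x30 x31 x33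
  - x03 * hd3 x10 x11 x12 x20 x21 x22 x30 x31 x32

def hd5 {R : Type*} [CommRing R]
    (x00 x01 x02 x03 x04 x10 x11 x12 x13 x14 x20 x21 x22 x23 x24 x30 x31 x32 x33 x34 x40 x41 x42 x43 x44 : R) : R :=
  x00 * hd4 x11 x12 x13 x14 x21 x22 x23 x24 x31 x32 x33 x34 x41 x42 x43 x44
  - x01 * hd4 x10 x12 x13 x14 x20 x22 x23 x24 x30 x32 x33 x34 x40 x42 x43 x44 + x02 * hd4 x10 x11 x13 x14 x20 x21 x23 x24 x30 x31 x33 x34 x40 x41 x43 x44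
  - x03 * hd4 x10 x11 x12 x14 x20 x21 x22 x24 x30 x31 x32 x34 x40 x41 x42 x44 + x04 * hd4 x10 x11 x12 x13 x20 x21 x22 x23 x30 x31 x32 x33 x40 x41 x42 x43

/-- The norm form of `R[x]/(x⁵ + x³ + x² - x - 1)`. -/
def hnorm {R : Type*} [CommRing R] (a b c d e : R) : R :=
  hd5 a e d (c - e) (b - d - e)
    b (a + e) (d + e) (c + d - e) (b + c - d - 2*e)
    c (b - e) (a - d + e) (-c + d + 2*e) (-b + c + 2*d)
    d (c - e) (b - d - e) (a - c - d + 2*e) (-b - c + 2*d + 3*e)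
    e d (c - e) (b - d - e) (a - c - d + 2*e)

lemma det_hd5 {R : Type*} [CommRing R] 
    (x00 x01 x02 x03 x04 x10 x11 x12 x13 x14 x20 x21 x22 x23 x24 x30 x31 x32 x33 x34 x40 x41 x42 x43 x44 : R) :
    (!![x00, x01, x02, x03, x04; x10, x11, x12, x13, x14; x20, x21, x22, x23, x24; x30, x31, x32, x33, x34; x40, x41, x42, x43, x44] : Matrix (Fin 5) (Fin 5) R).det
      = hd5 x00 x01 x02 x03 x04 x10 x11 x12 x13 x14 x20 x21 x22 x23 x24 x30 x31 x32 x33 x34 x40 x41 x42 x43 x44 := by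
  simp [Matrix.det_succ_row_zero, Fin.sum_univ_succ, Fin.succAbove]
  simp only [hd5, hd4, hd3, hd2]
  ring

set_option maxHeartbeats 2000000 in
lemma det_lin {R : Type*} [CommRing R] (a b c d e : R) :
    (a • (1 : Matrix (Fin 5) (Fin 5) R) + b • hC R + c • (hC R * hC R) + d • (hC R * hC R * hC R)
      + e • (hC R * hC R * hC R * hC R)).det = hnorm a b c d e := by
  have e2 : hC R * hC R = !![0,0,0,1,0;0,0,0,1,1;1,0,0,-1,1;0,1,0,-1,-1;0,0,1,0,-1] := by
    simp [hC]
  have e3 : hC R * hC R * hC R = !![0,0,1,0,-1;0,0,1,1,-1;0,0,-1,1,2;1,0,-1,-1,2;0,1,0,-1,-1] := by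
    rw [e2]; ext i j; fin_cases i <;> fin_cases j <;> simp [hC] <;> ring
  have e4 : hC R * hC R * hC R * hC R
      = !![0,1,0,-1,-1;0,1,1,-1,-2;0,-1,1,2,0;0,-1,-1,2,3;1,0,-1,-1,2] := by
    rw [e3]; ext i j; fin_cases i <;> fin_cases j <;> simp [hC] <;> ring
  have : a • (1 : Matrix (Fin 5) (Fin 5) R) + b • hC R + c • (hC R * hC R)
      + d • (hC R * hC R * hC R) + e • (hC R * hC R * hC R * hC R) =
      !![a, e, d, c - e, b - d - e;
         b, a + e, d + e, c + d - e, b + c - d - 2*e;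
         c, b - e, a - d + e, -c + d + 2*e, -b + c + 2*d;
         d, c - e, b - d - e, a - c - d + 2*e, -b - c + 2*d + 3*e;
         e, d, c - e, b - d - e, a - c - d + 2*e] := by
    rw [e4, e3, e2]
    ext i j; fin_cases i <;> fin_cases j <;> simp [hC] <;> ring
  rw [this, det_hd5]
  rfl

lemma hc0 : hc 0 = 1 := by
  rw [hc_eq]
  have : ∀ a : Fin 0 → ZMod 3, (hC (ZMod 3) ^ 0 + ∑ i, a i • hC (ZMod 3) ^ (i : ℕ)).det = 1 := by
    intro a; simp
  simp only [this]; decide +kernel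

lemma hc1 : hc 1 = -1 := by
  rw [hc_eq]
  have : ∀ a : Fin 1 → ZMod 3, (hC (ZMod 3) ^ 1 + ∑ i, a i • hC (ZMod 3) ^ (i : ℕ)).det =
      hnorm (a 0) 1 0 0 0 := by
    intro a; rw [← det_lin]; simp [Fin.sum_univ_succ]; congr 1; abel
  simp only [this]; decide +kernel

lemma hc2 : hc 2 = 1 := by
  rw [hc_eq]
  have : ∀ a : Fin 2 → ZMod 3, (hC (ZMod 3) ^ 2 + ∑ i, a i • hC (ZMod 3) ^ (i : ℕ)).det =
      hnorm (a 0) (a 1) 1 0 0 := by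
    intro a; rw [← det_lin]; simp [Fin.sum_univ_succ, pow_succ]; congr 1; abel
  simp only [this]; decide +kernel

lemma hc3 : hc 3 = -3 := by
  rw [hc_eq]
  have : ∀ a : Fin 3 → ZMod 3, (hC (ZMod 3) ^ 3 + ∑ i, a i • hC (ZMod 3) ^ (i : ℕ)).det =
      hnorm (a 0) (a 1) (a 2) 1 0 := by
    intro a; rw [← det_lin]; simp [Fin.sum_univ_succ, pow_succ]; congr 1; abel
  simp only [this]; decide +kernel

lemma hc4 : hc 4 = 9 := by
  rw [hc_eq]
  have : ∀ a : Fin 4 → ZMod 3, (hC (ZMod 3) ^ 4 + ∑ i, a i • hC (ZMod 3) ^ (i : ℕ)).det =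
      hnorm (a 0) (a 1) (a 2) (a 3) 1 := by
    intro a; rw [← det_lin]; simp [Fin.sum_univ_succ, pow_succ]; congr 1; abel
  simp only [this]; decide +kernel

lemma hchi_mul {g h : (ZMod 3)[X]} (hg : g.Monic) (hh : h.Monic) :
    hchi (g * h) = hchi g * hchi h := by
  unfold hchi
  rw [hg.natDegree_mul hh, ← map_mul (quadraticChar (ZMod 3)), map_mul (aeval (hC (ZMod 3))),
    Matrix.det_mul, pow_add, mul_mul_mul_comm]

lemma hc_big (d : ℕ) (hd : 5 ≤ d) : hc d = 0 := by
  set f : (ZMod 3)[X] := X ^ 5 + X ^ 3 + X ^ 2 - X - 1 with hfdef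
  have hnd : f.natDegree = 5 := by rw [hfdef]; compute_degree!
  have hfm : f.Monic := by rw [hfdef]; monicity!
  have key : ∀ g ∈ hM d, g + g %ₘ f ∈ hM d ∧ hchi (g + g %ₘ f) = - hchi g ∧
      (g + g %ₘ f) + (g + g %ₘ f) %ₘ f = g := by
    intro g hg
    rw [mem_hM] at hg
    obtain ⟨hgm, hgd⟩ := hg
    have hlt : (g %ₘ f).degree < g.degree := by
      refine (degree_modByMonic_lt g hfm).trans_le ?_
      rw [degree_eq_natDegree hfm.ne_zero, degree_eq_natDegree hgm.ne_zero, hnd, hgd]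
      exact_mod_cast hd
    have hD : (g + g %ₘ f).natDegree = d := by
      rw [natDegree_add_eq_left_of_degree_lt hlt, hgd]
    refine ⟨(mem_hM _ _).2 ⟨hgm.add_of_left hlt, hD⟩, ?_, ?_⟩
    · have e1 : aeval (hC (ZMod 3)) g = aeval (hC (ZMod 3)) (g %ₘ f) := by
        conv_lhs => rw [← modByMonic_add_div g f]
        rw [map_add, map_mul, hC_root]; simp
      have e2 : aeval (hC (ZMod 3)) (g + g %ₘ f) = - aeval (hC (ZMod 3)) g := by
        rw [map_add, ← e1]
        generalize aeval (hC (ZMod 3)) g = m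
        ext i j
        simp only [Matrix.add_apply, Matrix.neg_apply]
        generalize m i j = t
        revert t; decide
      rw [hchi, hchi, hD, hgd, e2, Matrix.det_neg]
      have : ∀ s t : ZMod 3, quadraticChar (ZMod 3) (s * ((-1) ^ 5 * t)) = - quadraticChar (ZMod 3) (s * t) := by
        decide
      simpa using this _ _
    · rw [add_modByMonic, (modByMonic_eq_self_iff hfm).2 (degree_modByMonic_lt g hfm)]
      have h3 : (3 : (ZMod 3)[X]) = 0 := by
        have : (3 : ZMod 3) = 0 := by decide
        rw [← C_ofNat, this, C_0]
      linear_combination (g %ₘ f) * h3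
  have : hc d = - hc d := by
    rw [hc, ← Finset.sum_neg_distrib]
    refine Finset.sum_nbij' (fun g => g + g %ₘ f) (fun g => g + g %ₘ f) ?_ ?_ ?_ ?_ ?_
    · intro g hg; exact (key g hg).1
    · intro g hg; exact (key g hg).1
    · intro g hg; exact (key g hg).2.2
    · intro g hg; exact (key g hg).2.2
    · intro g hg; rw [(key g hg).2.1, neg_neg]
  omega

lemma sum_dvd (d k : ℕ) (hk : k ≤ d) (q : (ZMod 3)[X]) (hq : q.Monic) (hqd : q.natDegree = k) 
    [DecidablePred (fun g => q ∣ g)] :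
    ∑ g ∈ hM d with q ∣ g, hchi g = hchi q * hc (d - k) := by
  rw [hc, Finset.mul_sum]
  symm
  refine Finset.sum_bij (fun h _ => q * h) ?_ ?_ ?_ ?_
  · intro h hh
    rw [mem_hM] at hh
    rw [Finset.mem_filter, mem_hM]
    refine ⟨⟨hq.mul hh.1, ?_⟩, dvd_mul_right _ _⟩
    rw [hq.natDegree_mul hh.1]; omega
  · intro a _ b _ hab
    exact mul_left_cancel₀ hq.ne_zero hab
  · intro g hg
    rw [Finset.mem_filter, mem_hM] at hg
    obtain ⟨⟨h1, h2⟩, h, rfl⟩ := hg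
    have hm : h.Monic := hq.of_mul_monic_left h1
    rw [hq.natDegree_mul hm] at h2
    exact ⟨h, (mem_hM _ _).2 ⟨hm, by omega⟩, rfl⟩
  · intro h hh
    rw [mem_hM] at hh
    rw [hchi_mul hq hh.1]

set_option linter.unusedSectionVars false

section Frob
variable {K : Type*} [Field K] [Algebra (ZMod 3) K] [CharP K 3]

noncomputable def hPi (k : ℕ) (x : K) : K[X] := ∏ i ∈ Finset.range k, (X - C (x ^ 3 ^ i))

lemma hPi_monic (k : ℕ) (x : K) : (hPi k x).Monic :=
  monic_prod_of_monic _ _ fun _ _ => monic_X_sub_C _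

lemma hPi_natDegree (k : ℕ) (x : K) : (hPi k x).natDegree = k := by
  rw [hPi, natDegree_prod_of_monic _ _ fun _ _ => monic_X_sub_C _]
  simp [natDegree_X_sub_C, -map_pow]

lemma hPi_frob (k : ℕ) (x : K) (hx : x ^ 3 ^ k = x) : (hPi k x).map (frobenius K 3) = hPi k x := by
  have h1 : (hPi k x).map (frobenius K 3) = ∏ i ∈ Finset.range k, (X - C (x ^ 3 ^ (i + 1))) := by
    rw [hPi, Polynomial.map_prod]
    refine Finset.prod_congr rfl fun i _ => ?_
    simp only [Polynomial.map_sub, map_X, map_C, frobenius_def, ← pow_mul, ← pow_succ]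
  rw [h1, hPi]
  have h2 := Finset.prod_range_succ (fun i => (X - C (x ^ 3 ^ i) : K[X])) k
  rw [Finset.prod_range_succ'] at h2
  simp only [hx, pow_zero, pow_one] at h2
  exact mul_right_cancel₀ (X_sub_C_ne_zero x) h2

lemma hPi_lift (k : ℕ) (x : K) (hx : x ^ 3 ^ k = x) :
    ∃ q : (ZMod 3)[X], q.map (algebraMap (ZMod 3) K) = hPi k x := by
  have : hPi k x ∈ lifts (algebraMap (ZMod 3) K) := by
    rw [lifts_iff_coeff_lifts]
    intro n
    have h := congrArg (fun p => coeff p n) (hPi_frob k x hx)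
    simp only [coeff_map, frobenius_def] at h
    generalize (hPi k x).coeff n = a at h
    have h' : a * ((a - 1) * (a + 1)) = 0 := by linear_combination h
    rcases mul_eq_zero.1 h' with h | h
    · exact ⟨0, by simp [h]⟩
    rcases mul_eq_zero.1 h with h | h
    · exact ⟨1, by simp [sub_eq_zero.1 h]⟩
    · exact ⟨-1, by simp [eq_neg_of_add_eq_zero_left h]⟩
  exact (mem_lifts _).1 this

open Classical in
noncomputable def hQ (k : ℕ) (x : K) : (ZMod 3)[X] :=
  if h : x ^ 3 ^ k = x then (hPi_lift k x h).choose else 1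

lemma hQ_map (k : ℕ) (x : K) (hx : x ^ 3 ^ k = x) :
    (hQ k x).map (algebraMap (ZMod 3) K) = hPi k x := by
  rw [hQ, dif_pos hx]; exact (hPi_lift k x hx).choose_spec

lemma hQ_monic (k : ℕ) (x : K) (hx : x ^ 3 ^ k = x) : (hQ k x).Monic := by
  apply monic_of_injective (algebraMap (ZMod 3) K).injective
  rw [hQ_map k x hx]; exact hPi_monic k x

lemma hQ_natDegree (k : ℕ) (x : K) (hx : x ^ 3 ^ k = x) : (hQ k x).natDegree = k := by
  rw [← natDegree_map (algebraMap (ZMod 3) K), hQ_map k x hx, hPi_natDegree]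

lemma hC_map : (algebraMap (ZMod 3) K).mapMatrix (hC (ZMod 3)) = hC K := by
  ext i j; fin_cases i <;> fin_cases j <;> simp [hC]

lemma det_hPi (k : ℕ) (x : K) :
    (aeval (hC K) (hPi k x)).det = ∏ i ∈ Finset.range k, (- hf (x ^ 3 ^ i)) := by
  induction k with
  | zero => simp [hPi]
  | succ k ih =>
    have : hPi (k + 1) x = hPi k x * (X - C (x ^ 3 ^ k)) := by
      rw [hPi, Finset.prod_range_succ]; rfl
    rw [this, map_mul, Matrix.det_mul, ih, Finset.prod_range_succ, ← det_hC]
    simp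

lemma hf_frob (x : K) (i : ℕ) : hf (x ^ 3 ^ i) = hf x ^ 3 ^ i := by
  have := congrArg id (map_pow (iterateFrobenius K 3 i) x 5)
  have h : hf (iterateFrobenius K 3 i x) = iterateFrobenius K 3 i (hf x) := by
    simp [hf]
  simpa only [iterateFrobenius_def] using h

lemma hchi_hQ (k : ℕ) (x : K) (hx : x ^ 3 ^ k = x) :
    ((hchi (hQ k x) : ℤ) : K) = hf x ^ ((3 ^ k - 1) / 2) := by
  have h0 : ∀ a : ZMod 3, ((quadraticChar (ZMod 3) a : ℤ) : ZMod 3) = a := by decide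
  have h1 : ∀ a : ZMod 3, ((quadraticChar (ZMod 3) a : ℤ) : K) = algebraMap (ZMod 3) K a := by
    intro a
    conv_rhs => rw [← h0 a]
    simp
  have h2 : algebraMap (ZMod 3) K (aeval (hC (ZMod 3)) (hQ k x)).det
      = ∏ i ∈ Finset.range k, (- hf (x ^ 3 ^ i)) := by
    rw [RingHom.map_det, ← det_hPi, ← hQ_map k x hx, ← hC_map (K := K), aeval_def, aeval_def, eval₂_map,
      hom_eval₂]
    congr 2
    exact Subsingleton.elim _ _
  rw [hchi, h1, map_mul, h2, hQ_natDegree k x hx, Finset.prod_neg, map_pow, map_neg, map_one,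
    Finset.card_range, ← mul_assoc, ← mul_pow]
  simp only [mul_neg, mul_one, neg_neg, one_pow, one_mul, hf_frob]
  rw [Finset.prod_pow_eq_pow_sum, Nat.geomSum_eq (by norm_num)]

/-- multiplicity criterion -/
lemma hPi_mul_period (x : K) (m j : ℕ) (hm : x ^ 3 ^ m = x) : hPi (m * j) x = hPi m x ^ j := by
  induction j with
  | zero => simp [hPi]
  | succ j ih =>
    have hp : x ^ 3 ^ (m * j) = x := by
      clear ih
      induction j with
      | zero => simp
      | succ j ih => rw [Nat.mul_succ, pow_add, pow_mul, ih, hm]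
    rw [Nat.mul_succ, pow_succ, ← ih, hPi, hPi, hPi, Finset.prod_range_add]
    congr 1
    refine Finset.prod_congr rfl fun i _ => ?_
    rw [pow_add, pow_mul, hp]

lemma frob_map (g : (ZMod 3)[X]) : (g.map (algebraMap (ZMod 3) K)).map (frobenius K 3) =
    g.map (algebraMap (ZMod 3) K) := by
  rw [Polynomial.map_map]; congr 1; exact Subsingleton.elim _ _

lemma dvd_frob (g : (ZMod 3)[X]) (x : K) (j i : ℕ)
    (h : (X - C x) ^ j ∣ g.map (algebraMap (ZMod 3) K)) :
    (X - C (x ^ 3 ^ i)) ^ j ∣ g.map (algebraMap (ZMod 3) K) := by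
  induction i with
  | zero => simpa using h
  | succ i ih =>
    have := Polynomial.map_dvd (frobenius K 3) ih
    rw [frob_map] at this
    simpa only [Polynomial.map_pow, Polynomial.map_sub, map_X, map_C, frobenius_def, ← pow_mul,
      ← pow_succ] using this

lemma iter_frob (x : K) (i : ℕ) : (frobenius K 3)^[i] x = x ^ 3 ^ i := by
  simp [iterate_frobenius]

lemma hPi_pow_dvd (g : (ZMod 3)[X]) (hg : g ≠ 0) (x : K) (j : ℕ)
    (hm : 0 < Function.minimalPeriod (frobenius K 3) x) :
    hPi (Function.minimalPeriod (frobenius K 3) x) x ^ j ∣ g.map (algebraMap (ZMod 3) K) ↔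
      j ≤ (g.map (algebraMap (ZMod 3) K)).rootMultiplicity x := by
  have hg' : g.map (algebraMap (ZMod 3) K) ≠ 0 := by
    rwa [Ne, Polynomial.map_eq_zero]
  rw [le_rootMultiplicity_iff hg', hPi]
  constructor
  · intro h
    refine dvd_trans (pow_dvd_pow_of_dvd ?_ j) h
    have := Finset.dvd_prod_of_mem (fun i => (X - C (x ^ 3 ^ i) : K[X])) (Finset.mem_range.2 hm)
    simpa using this
  · intro h
    rw [← Finset.prod_pow]
    refine Finset.prod_dvd_of_coprime ?_ fun i _ => dvd_frob g x j i h
    intro a ha b hb hab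
    apply IsCoprime.pow
    apply isCoprime_X_sub_C_of_isUnit_sub
    rw [isUnit_iff_ne_zero, sub_ne_zero, ← iter_frob, ← iter_frob]
    intro h
    exact hab (Function.iterate_injOn_Iio_minimalPeriod (by simpa using ha) (by simpa using hb) h)

lemma period_pos (g : (ZMod 3)[X]) (hg : g ≠ 0) (x : K)
    (hx : (g.map (algebraMap (ZMod 3) K)).IsRoot x) :
    0 < Function.minimalPeriod (frobenius K 3) x := by
  classical
  have hg' : g.map (algebraMap (ZMod 3) K) ≠ 0 := by
    rwa [Ne, Polynomial.map_eq_zero]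
  have hr : ∀ i, (frobenius K 3)^[i] x ∈ (g.map (algebraMap (ZMod 3) K)).roots.toFinset := by
    intro i
    rw [Multiset.mem_toFinset, mem_roots hg', ← dvd_iff_isRoot, iter_frob]
    simpa using dvd_frob g x 1 i (by simpa using dvd_iff_isRoot.2 hx)
  have : ¬ Function.Injective (fun i : ℕ => (frobenius K 3)^[i] x) := by
    intro hinj
    exact (Set.infinite_range_of_injective hinj) (Set.Finite.subset
      (Finset.finite_toSet (g.map (algebraMap (ZMod 3) K)).roots.toFinset)
      (by rintro _ ⟨i, rfl⟩; exact hr i))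
  rw [Function.Injective] at this
  push Not at this
  obtain ⟨a, b, hab, hne⟩ := this
  wlog hlt : a < b generalizing a b
  · exact this b a hab.symm hne.symm (by omega)
  have h3 : (frobenius K 3)^[b - a] x = x := by
    apply (frobenius_inj K 3).iterate a
    rw [← Function.iterate_add_apply]
    have hba : a + (b - a) = b := by omega
    rw [hba]; exact hab.symm
  exact Function.IsPeriodicPt.minimalPeriod_pos (n := b - a) (by omega) h3

variable [IsAlgClosed K]

open Classical in
lemma count_k (g : (ZMod 3)[X]) (hg : g.Monic) (x : K)
    (hx : (g.map (algebraMap (ZMod 3) K)).IsRoot x) :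
    ((Finset.Icc 1 g.natDegree).filter (fun k => x ^ 3 ^ k = x ∧
      hPi k x ∣ g.map (algebraMap (ZMod 3) K))).card =
      (g.map (algebraMap (ZMod 3) K)).rootMultiplicity x := by
  have hm := period_pos g hg.ne_zero x hx
  have hd := hPi_pow_dvd g hg.ne_zero x
  have hmp : x ^ 3 ^ (Function.minimalPeriod (frobenius K 3) x) = x := by
    rw [← iter_frob]; exact Function.iterate_minimalPeriod
  have hdv : ∀ k, x ^ 3 ^ k = x → Function.minimalPeriod (frobenius K 3) x ∣ k := by
    intro k hk
    rw [← iter_frob] at hk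
    exact Function.IsPeriodicPt.minimalPeriod_dvd hk
  set m := Function.minimalPeriod (frobenius K 3) x
  set μ := (g.map (algebraMap (ZMod 3) K)).rootMultiplicity x
  have himg : ((Finset.Icc 1 g.natDegree).filter (fun k => x ^ 3 ^ k = x ∧
      hPi k x ∣ g.map (algebraMap (ZMod 3) K))) = (Finset.Icc 1 μ).image (fun j => m * j) := by
    ext k
    simp only [Finset.mem_filter, Finset.mem_image, Finset.mem_Icc]
    constructor
    · rintro ⟨⟨h1, h2⟩, h3, h4⟩
      obtain ⟨j, rfl⟩ := hdv k h3
      rw [hPi_mul_period x m j hmp, hd j hm] at h4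
      exact ⟨j, ⟨by rcases j with _ | j <;> omega, h4⟩, rfl⟩
    · rintro ⟨j, ⟨h1, h2⟩, rfl⟩
      have h4 : hPi (m * j) x ∣ g.map (algebraMap (ZMod 3) K) := by
        rw [hPi_mul_period x m j hmp, hd j hm]; exact h2
      refine ⟨⟨Nat.mul_pos hm h1, ?_⟩, ?_, h4⟩
      · have := natDegree_le_of_dvd h4 (hg.map _).ne_zero
        rwa [hPi_natDegree, natDegree_map] at this
      · rw [← iter_frob]
        exact Function.IsPeriodicPt.mul_const (Function.isPeriodicPt_minimalPeriod _ _) j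
  rw [himg, Finset.card_image_of_injective _ (fun a b h => Nat.eq_of_mul_eq_mul_left hm h)]
  simp

variable (K) in
open Classical in
noncomputable def hR (k : ℕ) : Finset K := (X ^ 3 ^ k - X : K[X]).roots.toFinset

lemma mem_hR (k : ℕ) (hk : 1 ≤ k) (x : K) : x ∈ hR K k ↔ x ^ 3 ^ k = x := by
  have : (X ^ 3 ^ k - X : K[X]) ≠ 0 :=
    FiniteField.X_pow_card_sub_X_ne_zero K (Nat.one_lt_pow (by omega) (by norm_num))
  simp [hR, mem_roots this, sub_eq_zero]

open Classical in
lemma count_total (g : (ZMod 3)[X]) (hg : g.Monic) :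
    ∑ k ∈ Finset.Icc 1 g.natDegree, ((hR K k).filter (fun x => hQ k x ∣ g)).card
      = g.natDegree := by
  have hg' : g.map (algebraMap (ZMod 3) K) ≠ 0 := (hg.map _).ne_zero
  have h1 : ∀ k ∈ Finset.Icc 1 g.natDegree, (hR K k).filter (fun x => hQ k x ∣ g) =
      ((g.map (algebraMap (ZMod 3) K)).roots.toFinset).filter (fun x => x ^ 3 ^ k = x ∧
      hPi k x ∣ g.map (algebraMap (ZMod 3) K)) := by
    intro k hk
    rw [Finset.mem_Icc] at hk
    ext x
    rw [Finset.mem_filter, Finset.mem_filter, mem_hR k hk.1, Multiset.mem_toFinset, mem_roots hg']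
    constructor
    · rintro ⟨h1, h2⟩
      have h3 : hPi k x ∣ g.map (algebraMap (ZMod 3) K) := by
        rw [← hQ_map k x h1]; exact Polynomial.map_dvd _ h2
      refine ⟨?_, h1, h3⟩
      rw [← dvd_iff_isRoot]
      refine dvd_trans ?_ h3
      have := Finset.dvd_prod_of_mem (fun i => (X - C (x ^ 3 ^ i) : K[X])) (Finset.mem_range.2 hk.1)
      simpa [hPi] using this
    · rintro ⟨_, h1, h2⟩
      refine ⟨h1, ?_⟩
      rw [← hQ_map k x h1] at h2
      exact (Polynomial.map_dvd_map' _).1 h2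
  rw [Finset.sum_congr rfl fun k hk => congrArg Finset.card (h1 k hk)]
  simp only [Finset.card_filter]
  rw [Finset.sum_comm]
  simp only [← Finset.card_filter]
  rw [Finset.sum_congr rfl fun x hx => count_k g hg x
    ((mem_roots hg').1 (Multiset.mem_toFinset.1 hx))]
  simp only [← count_roots]
  rw [Multiset.toFinset_sum_count_eq, IsAlgClosed.card_roots_eq_natDegree, natDegree_map]

variable (K) in
noncomputable def hS (k : ℕ) : ℤ := ∑ x ∈ hR K k, hchi (hQ k x)

open Classical in
lemma main_rec (d : ℕ) : (d : ℤ) * hc d = ∑ k ∈ Finset.Icc 1 d, hS K k * hc (d - k) := by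
  calc (d : ℤ) * hc d = ∑ g ∈ hM d, ∑ k ∈ Finset.Icc 1 d, ∑ x ∈ hR K k,
        (if hQ k x ∣ g then hchi g else 0) := by
        rw [hc, Finset.mul_sum]
        refine Finset.sum_congr rfl fun g hg => ?_
        rw [mem_hM] at hg
        obtain ⟨hm, rfl⟩ := hg
        have := count_total (K := K) g hm
        conv_lhs => rw [← this]
        rw [Nat.cast_sum, Finset.sum_mul]
        refine Finset.sum_congr rfl fun k _ => ?_
        rw [← Finset.sum_filter, Finset.sum_const, nsmul_eq_mul]
    _ = ∑ k ∈ Finset.Icc 1 d, ∑ x ∈ hR K k, ∑ g ∈ hM d, (if hQ k x ∣ g then hchi g else 0) := by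
        rw [Finset.sum_comm]
        refine Finset.sum_congr rfl fun k _ => ?_
        rw [Finset.sum_comm]
    _ = _ := by
        refine Finset.sum_congr rfl fun k hk => ?_
        rw [Finset.mem_Icc] at hk
        rw [hS, Finset.sum_mul]
        refine Finset.sum_congr rfl fun x hx => ?_
        rw [mem_hR k hk.1] at hx
        rw [← Finset.sum_filter, sum_dvd d k hk.2 _ (hQ_monic k x hx) (hQ_natDegree k x hx)]

lemma sum_quad (n : ℕ) (hn : 1 ≤ n) [Fintype (GaloisField 3 n)] [DecidableEq (GaloisField 3 n)] :
    ∑ x : GaloisField 3 n, quadraticChar (GaloisField 3 n) (hf x) = hS K n := by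
  classical
  let ι : GaloisField 3 n →ₐ[ZMod 3] K := IsAlgClosed.lift
  have hinj : Function.Injective ι := ι.toRingHom.injective
  have hcard : Fintype.card (GaloisField 3 n) = 3 ^ n := by
    rw [← Nat.card_eq_fintype_card, GaloisField.card 3 n (by omega)]
  have hmem : ∀ x, ι x ^ 3 ^ n = ι x := by
    intro x
    rw [← map_pow, ← hcard, FiniteField.pow_card]
  have himg : hR K n = Finset.univ.image ι := by
    symm
    apply Finset.eq_of_subset_of_card_le
    · intro y hy
      obtain ⟨x, _, rfl⟩ := Finset.mem_image.1 hy
      exact (mem_hR n hn _).2 (hmem x)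
    · rw [Finset.card_image_of_injective _ hinj, Finset.card_univ, hcard, hR]
      refine (Multiset.toFinset_card_le _).trans ((card_roots' _).trans ?_)
      rw [FiniteField.X_pow_card_sub_X_natDegree_eq K (Nat.one_lt_pow (by omega) (by norm_num))]
  rw [hS, himg, Finset.sum_image hinj.injOn]
  refine Finset.sum_congr rfl fun x _ => ?_
  have hch : ringChar K = 3 := ringChar.eq_iff.2 inferInstance
  have hchL : ringChar (GaloisField 3 n) = 3 := ringChar.eq_iff.2 inferInstance
  refine MulChar.IsQuadratic.eq_of_eq_coe (R'' := K) (quadraticChar_isQuadratic _)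
    (quadraticChar_isQuadratic _) (by rw [hch]; norm_num) ?_
  change _ = ((hchi (hQ n (ι x)) : ℤ) : K)
  rw [hchi_hQ n _ (hmem x)]
  have h := congrArg ι (quadraticChar_eq_pow_of_char_ne_two' (by rw [hchL]; norm_num) (hf x))
  rw [map_intCast] at h
  rw [h, map_pow, hcard]
  have e1 : ι (hf x) = hf (ι x) := by simp [hf]
  have e2 : 3 ^ n / 2 = (3 ^ n - 1) / 2 := by
    have : Odd (3 ^ n) := Odd.pow (by decide)
    obtain ⟨t, ht⟩ := this
    omega
  rw [e1, e2]

end Frob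

lemma card_points (n : ℕ) (hn : 1 ≤ n) : (howeProjectivePointCount n : ℤ) =
    3 ^ n + 1 + hS (AlgebraicClosure (ZMod 3)) n := by
  classical
  have : CharP (AlgebraicClosure (ZMod 3)) 3 := inferInstance
  have : Fintype (GaloisField 3 n) := Fintype.ofFinite _
  have hchL : ringChar (GaloisField 3 n) = 3 := ringChar.eq_iff.2 inferInstance
  have hcard : Fintype.card (GaloisField 3 n) = 3 ^ n := by
    rw [← Nat.card_eq_fintype_card, GaloisField.card 3 n (by omega)]
  rw [← sum_quad n hn, howeProjectivePointCount]
  let e : {p : GaloisField 3 n × GaloisField 3 n //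
      p.2 ^ 2 = p.1 ^ 5 + p.1 ^ 3 + p.1 ^ 2 - p.1 - 1} ≃
      Σ x : GaloisField 3 n, {y : GaloisField 3 n // y ∈ {y : GaloisField 3 n | y ^ 2 = hf x}} :=
    { toFun := fun p => ⟨p.1.1, p.1.2, p.2⟩
      invFun := fun s => ⟨(s.1, s.2.1), s.2.2⟩
      left_inv := fun _ => rfl
      right_inv := fun _ => rfl }
  rw [Nat.card_congr e, Nat.card_eq_fintype_card, Fintype.card_sigma]
  push_cast
  have h : ∀ x : GaloisField 3 n,
      ((Fintype.card {y : GaloisField 3 n // y ∈ {y : GaloisField 3 n | y ^ 2 = hf x}} : ℕ) : ℤ) =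
      quadraticChar (GaloisField 3 n) (hf x) + 1 := by
    intro x
    rw [← quadraticChar_card_sqrts (by rw [hchL]; norm_num) (hf x), Set.toFinset_card]
  rw [Finset.sum_congr rfl fun x _ => h x, Finset.sum_add_distrib]
  simp [hcard]
  ring

lemma rec_general (c S : ℕ → ℤ) (h0 : c 0 = 1) (h1 : c 1 = -1) (h2 : c 2 = 1) (h3 : c 3 = -3)
    (h4 : c 4 = 9) (hb : ∀ d, 5 ≤ d → c d = 0)
    (hr : ∀ d : ℕ, (d : ℤ) * c d = ∑ k ∈ Finset.Icc 1 d, S k * c (d - k)) :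
    S 1 = -1 ∧ S 2 = 1 ∧ S 3 = -7 ∧ S 4 = 25 ∧
      ∀ n, S (n + 5) = S (n + 4) - S (n + 3) + 3 * S (n + 2) - 9 * S (n + 1) := by
  have r1 := hr 1
  have r2 := hr 2
  have r3 := hr 3
  have r4 := hr 4
  simp [Finset.sum_Icc_succ_top, h0, h1, h2, h3, h4] at r1 r2 r3 r4
  refine ⟨by omega, by omega, by omega, by omega, fun n => ?_⟩
  have r := hr (n + 5)
  rw [hb _ (by omega), Finset.sum_Icc_succ_top (by omega), Finset.sum_Icc_succ_top (by omega),
    Finset.sum_Icc_succ_top (by omega), Finset.sum_Icc_succ_top (by omega),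
    Finset.sum_Icc_succ_top (by omega), Finset.sum_eq_zero] at r
  · have a1 : n + 5 - (n + 1) = 4 := by omega
    have a2 : n + 5 - (n + 1 + 1) = 3 := by omega
    have a3 : n + 5 - (n + 1 + 1 + 1) = 2 := by omega
    have a4 : n + 5 - (n + 1 + 1 + 1 + 1) = 1 := by omega
    have a5 : n + 5 - (n + 1 + 1 + 1 + 1 + 1) = 0 := by omega
    simp only [Nat.add_assoc, Nat.reduceAdd] at r a1 a2 a3 a4 a5
    try rw [a1, a2, a3, a4, a5] at r
    simp only [h0, h1, h2, h3, h4] at r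
    linarith
  · intro k hk
    rw [Finset.mem_Icc] at hk
    rw [hb _ (by omega), mul_zero]

lemma roots_spec : ∃ a b c d : ℂ,
    (X ^ 4 - X ^ 3 + X ^ 2 - C 3 * X + C 9 : ℂ[X]).roots = {a, b, c, d} ∧
    a + b + c + d = 1 ∧ a*b + a*c + a*d + b*c + b*d + c*d = 1 ∧
    a*b*c + a*b*d + a*c*d + b*c*d = 3 ∧ a*b*c*d = 9 := by
  set p := (X ^ 4 - X ^ 3 + X ^ 2 - C 3 * X + C 9 : ℂ[X]) with hp
  have hm : p.Monic := by rw [hp]; monicity!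
  have hd : p.natDegree = 4 := by rw [hp]; compute_degree!
  have hc : p.roots.card = 4 := by rw [IsAlgClosed.card_roots_eq_natDegree, hd]
  obtain ⟨a, b, c, d, h⟩ := Multiset.card_eq_four.1 hc
  refine ⟨a, b, c, d, h, ?_⟩
  have hprod := (IsAlgClosed.splits p).eq_prod_roots_of_monic hm
  rw [h] at hprod
  have he : ∀ z : ℂ, z^4 - z^3 + z^2 - 3*z + 9 = (z-a)*(z-b)*(z-c)*(z-d) := by
    intro z
    have := congrArg (eval z) hprod
    simp [hp] at this
    rw [this]; ring
  have e0 := he 0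
  have e1 := he 1
  have e2 := he (-1)
  have e3 := he 2
  refine ⟨?_, ?_, ?_, ?_⟩
  · linear_combination (1/2) * e0 - (1/2) * e1 - (1/6) * e2 + (1/6) * e3
  · linear_combination e0 - (1/2) * e1 - (1/2) * e2
  · linear_combination (-1/2) * e0 + e1 - (1/3) * e2 - (1/6) * e3
  · linear_combination -e0

/-- For every `n ≥ 1`, the point count `N n` of the curve `y² = x⁵ + x³ + x² − x − 1` over
`𝔽_{3ⁿ}` satisfies `N n = 3ⁿ + 1 − ∑ αᵢⁿ`, where `α₁, …, α₄` are the complex roots (with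
multiplicity) of `z⁴ − z³ + z² − 3z + 9`; equivalently, the zeta function of the curve is
`(1 − T + T² − 3T³ + 9T⁴)/((1 − T)(1 − 3T))`. -/
theorem howe_point_count_eq (n : ℕ) (hn : 1 ≤ n) :
    (howeProjectivePointCount n : ℂ) =
      3 ^ n + 1 -
        (((X ^ 4 - X ^ 3 + X ^ 2 - C 3 * X + C 9 : ℂ[X]).roots).map (fun α => α ^ n)).sum := by
  obtain ⟨a, b, c, d, hr, e1, e2, e3, e4⟩ := roots_spec
  have hcp := congrArg (Int.cast : ℤ → ℂ) (card_points n hn)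
  push_cast at hcp
  rw [hcp, hr]
  obtain ⟨s1, s2, s3, s4, s5⟩ := rec_general hc (hS (AlgebraicClosure (ZMod 3)))
    hc0 hc1 hc2 hc3 hc4 hc_big main_rec
  have key : ∀ n, 1 ≤ n → (hS (AlgebraicClosure (ZMod 3)) n : ℂ) = - (a^n + b^n + c^n + d^n) := by
    have hz : ∀ z : ℂ, (z-a)*(z-b)*(z-c)*(z-d) = z^4 - z^3 + z^2 - 3*z + 9 := by
      intro z
      linear_combination (-z^3) * e1 + z^2 * e2 - z * e3 + e4
    have ha := hz a
    have hb := hz b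
    have hc := hz c
    have hd := hz d
    simp only [sub_self, zero_mul, mul_zero] at ha hb hc hd
    intro n
    induction n using Nat.strong_induction_on with
    | _ n ih =>
      intro hn
      have p1 : a + b + c + d = 1 := e1
      have p2 : a^2 + b^2 + c^2 + d^2 = -1 := by
        linear_combination (a+b+c+d+1) * e1 - 2 * e2
      have p3 : a^3 + b^3 + c^3 + d^3 = 7 := by
        linear_combination p2 - e2 * (a+b+c+d) + 3 * e3 + (a^2+b^2+c^2+d^2) * (e1) - e1
      have p4 : a^4 + b^4 + c^4 + d^4 = -25 := by
        linear_combination -(ha + hb + hc + hd) + p3 - p2 + 3 * p1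
      match n, hn with
      | 1, _ => rw [s1]; push_cast; linear_combination p1
      | 2, _ => rw [s2]; push_cast; linear_combination p2
      | 3, _ => rw [s3]; push_cast; linear_combination p3
      | 4, _ => rw [s4]; push_cast; linear_combination p4
      | m + 5, _ =>
        rw [s5]
        push_cast
        rw [ih (m+4) (by omega) (by omega), ih (m+3) (by omega) (by omega),
          ih (m+2) (by omega) (by omega), ih (m+1) (by omega) (by omega)]
        linear_combination -(a^(m+1) * ha + b^(m+1) * hb + c^(m+1) * hc + d^(m+1) * hd)
  rw [key n hn]
  simp
  ring
end
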